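/- Assume 0 < p < 1/2. With f_{n_0+i} the lowest-branch spectral-decimation extensions of a Δ_{n_0}-eigenfunction f_{n_0}, the sequence of piecewise-affine interpolations (f̃_{n_0+i})_{i≥0} converges uniformly on [0,1] as i → ∞; in particular, its limit is a continuous function on [0,1]. -/

import Mathlib

noncomputable section

/-- Transition coefficients `a_{n,k}`: `a_{n+1,3k} = a_{n,k}`, `a_{n+1,3k+1} = q = 1-p`,
`a_{n+1,3k+2} = p`. -/
def a (p : ℝ) : ℕ → ℕ → ℝ
  | 0, _ => 0
  | n + 1, k =>
    if k % 3 = 1 then 1 - p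
    else if k % 3 = 2 then p
    else a p n (k / 3)

/-- The Neumann discrete Laplacian `Δ_n`. -/
def lap (p : ℝ) (n : ℕ) (f : ℕ → ℝ) (k : ℕ) : ℝ :=
  if k = 0 then f 0 - f 1
  else if k = 3 ^ n then f (3 ^ n) - f (3 ^ n - 1)
  else f k - a p n k * f (k - 1) - (1 - a p n k) * f (k + 1)

/-- The cubic polynomial `R(z) = z(z² − 3z + 2 + pq)/(pq)` with `q = 1 − p`. -/
def R (p z : ℝ) : ℝ := z * (z ^ 2 - 3 * z + 2 + p * (1 - p)) / (p * (1 - p))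

/-- The spectral-decimation extension with parameter `z`. -/
def sdExt (p z : ℝ) (f : ℕ → ℝ) (m : ℕ) : ℝ :=
  if m % 3 = 0 then f (m / 3)
  else if m % 3 = 1 then
    ((1 - p) * (1 - z) * f (m / 3) + p * (1 - p) * f (m / 3 + 1)) /
      ((1 - p - z) * (1 + p - z))
  else
    ((1 - p) * (1 - z) * f (m / 3 + 1) + p * (1 - p) * f (m / 3)) /
      ((1 - p - z) * (1 + p - z))

/-- Node points `x_{n,k}` with contraction ratio `r = p/(1+p)`. -/
def node (p : ℝ) : ℕ → ℕ → ℝ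
  | 0, k => if k = 0 then 0 else 1
  | n + 1, m =>
    if m % 3 = 0 then node p n (m / 3)
    else if m % 3 = 1 then
      node p n (m / 3) + (p / (1 + p)) * (node p n (m / 3 + 1) - node p n (m / 3))
    else
      node p n (m / 3 + 1) - (p / (1 + p)) * (node p n (m / 3 + 1) - node p n (m / 3))

open Classical in
/-- The piecewise-affine interpolation `f̃` of `f : {0,…,3^n} → ℝ`: on each interval
`[x_{n,k}, x_{n,k+1}]` it is affine with `f̃(x_{n,k}) = f(k)`. -/
def interp (p : ℝ) (n : ℕ) (f : ℕ → ℝ) (x : ℝ) : ℝ :=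
  let k := Nat.findGreatest (fun j => node p n j ≤ x ∧ j < 3 ^ n) (3 ^ n)
  f k + (f (k + 1) - f k) * (x - node p n k) / (node p n (k + 1) - node p n k)
/-! ### Values of nodes and extensions by residue modulo three -/

lemma node_three_mul (p : ℝ) (n k : ℕ) : node p (n + 1) (3 * k) = node p n k := by
  simp [node]

lemma node_three_mul_add_one (p : ℝ) (n k : ℕ) : node p (n + 1) (3 * k + 1) =
    node p n k + (p / (1 + p)) * (node p n (k + 1) - node p n k) := by
  have h1 : (3 * k + 1) % 3 = 1 := by omega
  have h2 : (3 * k + 1) / 3 = k := by omega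
  simp [node, h1, h2]

lemma node_three_mul_add_two (p : ℝ) (n k : ℕ) : node p (n + 1) (3 * k + 2) =
    node p n (k + 1) - (p / (1 + p)) * (node p n (k + 1) - node p n k) := by
  have h1 : (3 * k + 2) % 3 = 2 := by omega
  have h2 : (3 * k + 2) / 3 = k := by omega
  simp [node, h1, h2]

lemma sdExt_three_mul (p z : ℝ) (f : ℕ → ℝ) (k : ℕ) : sdExt p z f (3 * k) = f k := by
  simp [sdExt]

lemma sdExt_three_mul_add_one (p z : ℝ) (f : ℕ → ℝ) (k : ℕ) : sdExt p z f (3 * k + 1) =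
    ((1 - p) * (1 - z) * f k + p * (1 - p) * f (k + 1)) / ((1 - p - z) * (1 + p - z)) := by
  have h1 : (3 * k + 1) % 3 = 1 := by omega
  have h2 : (3 * k + 1) / 3 = k := by omega
  simp [sdExt, h1, h2]

lemma sdExt_three_mul_add_two (p z : ℝ) (f : ℕ → ℝ) (k : ℕ) : sdExt p z f (3 * k + 2) =
    ((1 - p) * (1 - z) * f (k + 1) + p * (1 - p) * f k) / ((1 - p - z) * (1 + p - z)) := by
  have h1 : (3 * k + 2) % 3 = 2 := by omega
  have h2 : (3 * k + 2) / 3 = k := by omega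
  simp [sdExt, h1, h2]

lemma exists_eq_three_mul_add (m : ℕ) :
    ∃ k, m = 3 * k ∨ m = 3 * k + 1 ∨ m = 3 * k + 2 :=
  ⟨m / 3, by omega⟩

/-! ### Ordering of the nodes -/

lemma node_zero (p : ℝ) (n : ℕ) : node p n 0 = 0 := by
  induction n with
  | zero => simp [node]
  | succ n ih => simpa [ih] using node_three_mul p n 0

lemma node_three_pow (p : ℝ) (n : ℕ) : node p n (3 ^ n) = 1 := by
  induction n with
  | zero => simp [node]
  | succ n ih => rw [pow_succ', node_three_mul, ih]

lemma div_one_add_lt_half {p : ℝ} (hp0 : 0 < p) (hp1 : p < 1) : p / (1 + p) < 1 / 2 := by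
  rw [div_lt_div_iff₀ (by linarith) two_pos]
  linarith

lemma node_le_succ {p : ℝ} (hp0 : 0 < p) (hp1 : p < 1) (n k : ℕ) :
    node p n k ≤ node p n (k + 1) := by
  induction n generalizing k with
  | zero => by_cases hk : k = 0 <;> simp [node, hk]
  | succ n ih =>
    have hr0 : 0 < p / (1 + p) := by positivity
    have hr := div_one_add_lt_half hp0 hp1
    obtain ⟨k, rfl | rfl | rfl⟩ := exists_eq_three_mul_add k
    · rw [node_three_mul, node_three_mul_add_one]
      nlinarith [ih k]
    · rw [node_three_mul_add_one, show 3 * k + 1 + 1 = 3 * k + 2 from rfl,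
        node_three_mul_add_two]
      nlinarith [ih k]
    · rw [node_three_mul_add_two, show 3 * k + 2 + 1 = 3 * (k + 1) from rfl, node_three_mul]
      nlinarith [ih k]

lemma node_mono {p : ℝ} (hp0 : 0 < p) (hp1 : p < 1) (n : ℕ) : Monotone (node p n) :=
  monotone_nat_of_le_succ (node_le_succ hp0 hp1 n)

lemma node_lt_succ {p : ℝ} (hp0 : 0 < p) (hp1 : p < 1) {n k : ℕ} (hk : k < 3 ^ n) :
    node p n k < node p n (k + 1) := by
  induction n generalizing k with
  | zero =>
    obtain rfl : k = 0 := by simpa using hk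
    simp [node]
  | succ n ih =>
    have hr0 : 0 < p / (1 + p) := by positivity
    have hr := div_one_add_lt_half hp0 hp1
    rw [pow_succ'] at hk
    obtain ⟨k, rfl | rfl | rfl⟩ := exists_eq_three_mul_add k
    · rw [node_three_mul, node_three_mul_add_one]
      nlinarith [ih (k := k) (by omega)]
    · rw [node_three_mul_add_one, show 3 * k + 1 + 1 = 3 * k + 2 from rfl,
        node_three_mul_add_two]
      nlinarith [ih (k := k) (by omega)]
    · rw [node_three_mul_add_two, show 3 * k + 2 + 1 = 3 * (k + 1) from rfl, node_three_mul]
      nlinarith [ih (k := k) (by omega)]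

lemma exists_mem_cell (p : ℝ) (n : ℕ) {x : ℝ} (hx : x ∈ Set.Icc (0 : ℝ) 1) :
    ∃ k < 3 ^ n, x ∈ Set.Icc (node p n k) (node p n (k + 1)) := by
  have key : ∀ N, x ≤ node p n N → N ≠ 0 →
      ∃ k < N, x ∈ Set.Icc (node p n k) (node p n (k + 1)) := by
    intro N
    induction N with
    | zero => simp
    | succ N ih =>
      intro hN _
      by_cases h : node p n N ≤ x
      · exact ⟨N, N.lt_succ_self, h, hN⟩
      · have hN0 : N ≠ 0 := by
          rintro rfl
          exact h (by rw [node_zero]; exact hx.1)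
        obtain ⟨k, hk, hkx⟩ := ih (not_le.mp h).le hN0
        exact ⟨k, hk.trans N.lt_succ_self, hkx⟩
  exact key _ (by rw [node_three_pow]; exact hx.2) (by positivity)

/-! ### The interpolation on a cell -/

lemma interp_eq_on_cell {p : ℝ} (hp0 : 0 < p) (hp1 : p < 1) {n k : ℕ} (f : ℕ → ℝ) {x : ℝ}
    (hk : k < 3 ^ n) (hx : x ∈ Set.Icc (node p n k) (node p n (k + 1))) :
    interp p n f x =
      f k + (f (k + 1) - f k) * (x - node p n k) / (node p n (k + 1) - node p n k) := by
  classical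
  have hlt := node_lt_succ hp0 hp1 hk
  by_cases h : k + 1 < 3 ^ n ∧ x = node p n (k + 1)
  · obtain ⟨h, rfl⟩ := h
    have hg : Nat.findGreatest (fun j => node p n j ≤ node p n (k + 1) ∧ j < 3 ^ n) (3 ^ n)
        = k + 1 := by
      rw [Nat.findGreatest_eq_iff]
      refine ⟨h.le, fun _ => ⟨le_rfl, h⟩, fun j hj _ hj' => ?_⟩
      have h1 := node_lt_succ hp0 hp1 h
      have h2 := node_mono hp0 hp1 n (show k + 1 + 1 ≤ j by omega)
      linarith [hj'.1]
    have hne : node p n (k + 1) - node p n k ≠ 0 := by linarith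
    simp only [interp]
    rw [show Nat.findGreatest (fun j => node p n j ≤ node p n (k + 1) ∧ j < 3 ^ n) (3 ^ n)
        = k + 1 by convert hg]
    field_simp
    ring
  · have hg : Nat.findGreatest (fun j => node p n j ≤ x ∧ j < 3 ^ n) (3 ^ n) = k := by
      rw [Nat.findGreatest_eq_iff]
      refine ⟨hk.le, fun _ => ⟨hx.1, hk⟩, fun j hj _ hj' => h ⟨by omega, ?_⟩⟩
      exact le_antisymm hx.2 ((node_mono hp0 hp1 n (show k + 1 ≤ j by omega)).trans hj'.1)
    simp only [interp]
    rw [show Nat.findGreatest (fun j => node p n j ≤ x ∧ j < 3 ^ n) (3 ^ n) = k by convert hg]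

lemma continuousOn_interp {p : ℝ} (hp0 : 0 < p) (hp1 : p < 1) (n : ℕ) (f : ℕ → ℝ) :
    ContinuousOn (interp p n f) (Set.Icc 0 1) := by
  have key : ∀ N ≤ 3 ^ n, ContinuousOn (interp p n f) (Set.Icc 0 (node p n N)) := by
    intro N
    induction N with
    | zero => simp [node_zero]
    | succ N ih =>
      intro hN
      have h0 : 0 ≤ node p n N := by
        simpa [node_zero] using node_mono hp0 hp1 n N.zero_le
      rw [← Set.Icc_union_Icc_eq_Icc h0 (node_le_succ hp0 hp1 n N)]
      refine (ih (by omega)).union_of_isClosed ?_ isClosed_Icc isClosed_Icc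
      refine ContinuousOn.congr ?_ fun x hx => interp_eq_on_cell hp0 hp1 f (by omega) hx
      fun_prop
  simpa [node_three_pow] using key (3 ^ n) le_rfl

lemma abs_interp_sub_le {p : ℝ} (hp0 : 0 < p) (hp1 : p < 1) {n : ℕ} {f g : ℕ → ℝ} {ε x : ℝ}
    (hfg : ∀ k ≤ 3 ^ n, |f k - g k| ≤ ε) (hx : x ∈ Set.Icc (0 : ℝ) 1) :
    |interp p n f x - interp p n g x| ≤ ε := by
  obtain ⟨k, hk, hkx⟩ := exists_mem_cell p n hx
  rw [interp_eq_on_cell hp0 hp1 f hk hkx, interp_eq_on_cell hp0 hp1 g hk hkx]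
  have hlt := node_lt_succ hp0 hp1 hk
  set t := (x - node p n k) / (node p n (k + 1) - node p n k) with ht
  have ht0 : 0 ≤ t := div_nonneg (by linarith [hkx.1]) (by linarith)
  have ht1 : t ≤ 1 := (div_le_one (by linarith)).2 (by linarith [hkx.2])
  rw [mul_div_assoc, mul_div_assoc, ← ht]
  have h1 := abs_le.mp (hfg k hk.le)
  have h2 := abs_le.mp (hfg (k + 1) hk)
  rw [abs_le]
  constructor <;> nlinarith

/-- The extension with parameter `0` samples the interpolation at the refined nodes. -/
lemma interp_sdExt_zero {p : ℝ} (hp0 : 0 < p) (hp1 : p < 1) (n : ℕ) (f : ℕ → ℝ) {x : ℝ}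
    (hx : x ∈ Set.Icc (0 : ℝ) 1) :
    interp p (n + 1) (sdExt p 0 f) x = interp p n f x := by
  obtain ⟨m, hm, hmx⟩ := exists_mem_cell p (n + 1) hx
  rw [interp_eq_on_cell hp0 hp1 _ hm hmx]
  have hltm := node_lt_succ hp0 hp1 hm
  have hq : 1 - p ≠ 0 := by linarith
  have hp' : 1 + p ≠ 0 := by linarith
  rw [pow_succ'] at hm
  obtain ⟨k, hmk⟩ := exists_eq_three_mul_add m
  have hk : k < 3 ^ n := by omega
  have hlt := node_lt_succ hp0 hp1 hk
  have hkx : x ∈ Set.Icc (node p n k) (node p n (k + 1)) := by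
    rw [← node_three_mul, ← node_three_mul p n (k + 1)]
    exact ⟨(node_mono hp0 hp1 _ (by omega)).trans hmx.1,
      hmx.2.trans (node_mono hp0 hp1 _ (by omega))⟩
  rw [interp_eq_on_cell hp0 hp1 f hk hkx]
  have hd : node p n (k + 1) - node p n k ≠ 0 := by linarith
  have hdm : node p (n + 1) (m + 1) - node p (n + 1) m ≠ 0 := by linarith
  rcases hmk with rfl | rfl | rfl
  · rw [sdExt_three_mul_add_one, sdExt_three_mul]
    rw [node_three_mul_add_one, node_three_mul] at hdm ⊢
    generalize node p n (k + 1) = v at *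
    generalize node p n k = u at *
    have e : u + p / (1 + p) * (v - u) - u = p / (1 + p) * (v - u) := by ring
    rw [e]
    field_simp
    ring
  · rw [show 3 * k + 1 + 1 = 3 * k + 2 from rfl, sdExt_three_mul_add_one,
      sdExt_three_mul_add_two]
    rw [show 3 * k + 1 + 1 = 3 * k + 2 from rfl, node_three_mul_add_one,
      node_three_mul_add_two] at hdm ⊢
    generalize node p n (k + 1) = v at *
    generalize node p n k = u at *
    have e : v - p / (1 + p) * (v - u) - (u + p / (1 + p) * (v - u))
        = (1 - p) / (1 + p) * (v - u) := by field_simp; ring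
    rw [e]
    field_simp
    ring
  · rw [show 3 * k + 2 + 1 = 3 * (k + 1) from rfl] at hdm ⊢
    rw [sdExt_three_mul, sdExt_three_mul_add_two]
    rw [node_three_mul, node_three_mul_add_two] at hdm ⊢
    generalize node p n (k + 1) = v at *
    generalize node p n k = u at *
    have e : v - (v - p / (1 + p) * (v - u)) = p / (1 + p) * (v - u) := by ring
    rw [e]
    field_simp
    ring

/-! ### Estimates for the extension -/

lemma abs_extension_le {p z A B M : ℝ} (hp0 : 0 < p) (hp : p < 1 / 2) (hz0 : 0 ≤ z)
    (hzp : z ≤ p) (hA : |A| ≤ M) (hB : |B| ≤ M) :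
    |((1 - p) * (1 - z) * A + p * (1 - p) * B) / ((1 - p - z) * (1 + p - z))| ≤
      (1 + z / (1 - 2 * p)) * M := by
  have hM : 0 ≤ M := (abs_nonneg A).trans hA
  have h1 : 0 < 1 - p - z := by linarith
  have h2 : 0 < 1 + p - z := by linarith
  have hα : 0 ≤ (1 - p) * (1 - z) := mul_nonneg (by linarith) (by linarith)
  have hβ : 0 ≤ p * (1 - p) := mul_nonneg hp0.le (by linarith)
  have hnum : |(1 - p) * (1 - z) * A + p * (1 - p) * B| ≤ (1 - p) * (1 + p - z) * M := by
    calc |(1 - p) * (1 - z) * A + p * (1 - p) * B|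
        ≤ |(1 - p) * (1 - z) * A| + |p * (1 - p) * B| := abs_add_le _ _
      _ = (1 - p) * (1 - z) * |A| + p * (1 - p) * |B| := by
          rw [abs_mul, abs_mul (p * (1 - p)), abs_of_nonneg hα, abs_of_nonneg hβ]
      _ ≤ (1 - p) * (1 - z) * M + p * (1 - p) * M := by gcongr
      _ = (1 - p) * (1 + p - z) * M := by ring
  rw [abs_div, abs_of_pos (mul_pos h1 h2)]
  calc |(1 - p) * (1 - z) * A + p * (1 - p) * B| / ((1 - p - z) * (1 + p - z))
      ≤ (1 - p) * (1 + p - z) * M / ((1 - p - z) * (1 + p - z)) := by gcongr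
    _ = (1 + z / (1 - p - z)) * M := by field_simp; ring
    _ ≤ (1 + z / (1 - 2 * p)) * M := by
        have h : z / (1 - p - z) ≤ z / (1 - 2 * p) :=
          div_le_div_of_nonneg_left hz0 (by linarith) (by linarith)
        exact mul_le_mul_of_nonneg_right (by linarith) hM

lemma abs_extension_sub_le {p z A B M : ℝ} (hp0 : 0 < p) (hp : p < 1 / 2) (hz0 : 0 ≤ z)
    (hzp : z ≤ p) (hA : |A| ≤ M) (hB : |B| ≤ M) :
    |((1 - p) * (1 - z) * A + p * (1 - p) * B) / ((1 - p - z) * (1 + p - z)) -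
        ((1 - p) * (1 - 0) * A + p * (1 - p) * B) / ((1 - p - 0) * (1 + p - 0))| ≤
      4 * M * z / (1 - 2 * p) := by
  have hM : 0 ≤ M := (abs_nonneg A).trans hA
  have h1 : 0 < 1 - p - z := by linarith
  have h2 : 0 < 1 + p - z := by linarith
  have h3 : 0 < 1 - p := by linarith
  have h4 : 0 < 1 + p := by linarith
  have hα : 0 ≤ 1 + p ^ 2 - z := by nlinarith
  have hβ : 0 ≤ p * (2 - z) := mul_nonneg hp0.le (by linarith)
  have hD : 1 - 2 * p ≤ (1 - p - z) * (1 + p - z) * (1 + p) := by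
    have h5 : 1 - 2 * p ≤ 1 - p - z := by linarith
    have h6 : 1 ≤ (1 + p - z) * (1 + p) := by nlinarith
    nlinarith
  have e : ((1 - p) * (1 - z) * A + p * (1 - p) * B) / ((1 - p - z) * (1 + p - z)) -
        ((1 - p) * (1 - 0) * A + p * (1 - p) * B) / ((1 - p - 0) * (1 + p - 0)) =
      z * ((1 + p ^ 2 - z) * A + p * (2 - z) * B) /
        ((1 - p - z) * (1 + p - z) * (1 + p)) := by
    rw [sub_zero, sub_zero, sub_zero]
    field_simp
    ring
  have hnum : |(1 + p ^ 2 - z) * A + p * (2 - z) * B| ≤ 4 * M := by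
    calc |(1 + p ^ 2 - z) * A + p * (2 - z) * B|
        ≤ |(1 + p ^ 2 - z) * A| + |p * (2 - z) * B| := abs_add_le _ _
      _ = (1 + p ^ 2 - z) * |A| + p * (2 - z) * |B| := by
          rw [abs_mul, abs_mul (p * (2 - z)), abs_of_nonneg hα, abs_of_nonneg hβ]
      _ ≤ 2 * M + 2 * M := by
          gcongr
          · nlinarith
          · nlinarith
      _ = 4 * M := by ring
  have hD0 : 0 < 1 - 2 * p := by linarith
  rw [e, abs_div, abs_mul, abs_of_nonneg hz0, abs_of_pos (hD0.trans_le hD), mul_comm z]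
  gcongr

lemma abs_sdExt_le {p z M : ℝ} (hp0 : 0 < p) (hp : p < 1 / 2) (hz0 : 0 ≤ z) (hzp : z ≤ p)
    {n : ℕ} {f : ℕ → ℝ} (hf : ∀ k ≤ 3 ^ n, |f k| ≤ M) {m : ℕ} (hm : m ≤ 3 ^ (n + 1)) :
    |sdExt p z f m| ≤ (1 + z / (1 - 2 * p)) * M := by
  rw [pow_succ'] at hm
  obtain ⟨k, rfl | rfl | rfl⟩ := exists_eq_three_mul_add m
  · rw [sdExt_three_mul]
    have hk := hf k (by omega)
    have hc : 0 ≤ z / (1 - 2 * p) := div_nonneg hz0 (by linarith)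
    nlinarith [mul_nonneg hc ((abs_nonneg _).trans hk)]
  · rw [sdExt_three_mul_add_one]
    exact abs_extension_le hp0 hp hz0 hzp (hf _ (by omega)) (hf _ (by omega))
  · rw [sdExt_three_mul_add_two]
    exact abs_extension_le hp0 hp hz0 hzp (hf _ (by omega)) (hf _ (by omega))

lemma abs_sdExt_sub_le {p z M : ℝ} (hp0 : 0 < p) (hp : p < 1 / 2) (hz0 : 0 ≤ z) (hzp : z ≤ p)
    {n : ℕ} {f : ℕ → ℝ} (hf : ∀ k ≤ 3 ^ n, |f k| ≤ M) {m : ℕ} (hm : m ≤ 3 ^ (n + 1)) :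
    |sdExt p z f m - sdExt p 0 f m| ≤ 4 * M * z / (1 - 2 * p) := by
  rw [pow_succ'] at hm
  obtain ⟨k, rfl | rfl | rfl⟩ := exists_eq_three_mul_add m
  · have hM := (abs_nonneg _).trans (hf k (by omega))
    rw [sdExt_three_mul, sdExt_three_mul, sub_self, abs_zero]
    exact div_nonneg (by positivity) (by linarith)
  · rw [sdExt_three_mul_add_one, sdExt_three_mul_add_one]
    exact abs_extension_sub_le hp0 hp hz0 hzp (hf _ (by omega)) (hf _ (by omega))
  · rw [sdExt_three_mul_add_two, sdExt_three_mul_add_two]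
    exact abs_extension_sub_le hp0 hp hz0 hzp (hf _ (by omega)) (hf _ (by omega))

lemma le_R_div_four {p w : ℝ} (hp0 : 0 < p) (hp : p < 1 / 2) (hw0 : 0 ≤ w) (hwp : w ≤ p) :
    w ≤ R p w / 4 := by
  have hq : 0 < 1 - p := by linarith
  have h : 2 * (1 - p) ≤ w ^ 2 - 3 * w + 2 + p * (1 - p) := by nlinarith
  have h4 : 4 * (p * (1 - p)) ≤ 2 * (1 - p) := by nlinarith
  rw [R, le_div_iff₀ (by norm_num), le_div_iff₀ (mul_pos hp0 hq)]
  nlinarith [mul_le_mul_of_nonneg_left (h4.trans h) hw0]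

lemma continuous_limit_of_geometric {u : ℕ → ℝ → ℝ} {s : Set ℝ} {C r : ℝ} (hr0 : 0 ≤ r)
    (hr1 : r < 1) (hu : ∀ i, ContinuousOn (u i) s)
    (h : ∀ i, ∀ x ∈ s, |u (i + 1) x - u i x| ≤ C * r ^ i) :
    ∃ F : ℝ → ℝ, ContinuousOn F s ∧ TendstoUniformlyOn u F Filter.atTop s := by
  have hd : ∀ x ∈ s, ∀ i, dist (u i x) (u (i + 1) x) ≤ C * r ^ i := fun x hx i => by
    rw [dist_comm, Real.dist_eq]
    exact h i x hx
  have hlim : ∀ x, ∃ y, x ∈ s → Filter.Tendsto (fun i => u i x) Filter.atTop (nhds y) := by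
    intro x
    by_cases hx : x ∈ s
    · obtain ⟨y, hy⟩ := cauchySeq_tendsto_of_complete (cauchySeq_of_le_geometric r C hr1 (hd x hx))
      exact ⟨y, fun _ => hy⟩
    · exact ⟨0, fun hx' => absurd hx' hx⟩
  choose F hF using hlim
  have hunif : TendstoUniformlyOn u F Filter.atTop s := by
    rw [Metric.tendstoUniformlyOn_iff]
    intro ε hε
    have ht : Filter.Tendsto (fun i => C * r ^ i / (1 - r)) Filter.atTop (nhds 0) := by
      simpa using
        ((tendsto_pow_atTop_nhds_zero_of_lt_one hr0 hr1).const_mul C).div_const (1 - r)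
    filter_upwards [ht.eventually_lt_const hε] with i hi x hx
    rw [dist_comm]
    exact (dist_le_of_le_geometric_of_tendsto r C hr1 (hd x hx) (hF x hx) i).trans_lt hi
  exact ⟨F, hunif.continuousOn (Filter.Frequently.of_forall hu), hunif⟩

/-- The piecewise-affine interpolations of the lowest-branch spectral-decimation
extensions of an eigenfunction converge uniformly on `[0,1]` to a continuous limit. -/
theorem stmt8 (p : ℝ) (hp0 : 0 < p) (hp : p < 1 / 2)
    (φ : ℝ → ℝ)
    (hφmem : ∀ z ∈ Set.Icc (0 : ℝ) 2, φ z ∈ Set.Icc 0 (min p (1 - p)))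
    (hφinv : ∀ z ∈ Set.Icc (0 : ℝ) 2, R p (φ z) = z)
    (n₀ : ℕ) (lam : ℕ → ℝ) (fs : ℕ → ℕ → ℝ)
    (hlam0 : lam 0 ∈ Set.Icc (0 : ℝ) 2)
    (hlam : ∀ i, lam (i + 1) = φ (lam i))
    (hne : ∃ k ≤ 3 ^ n₀, fs 0 k ≠ 0)
    (heig : ∀ k ≤ 3 ^ n₀, lap p n₀ (fs 0) k = lam 0 * fs 0 k)
    (hfs : ∀ i, fs (i + 1) = sdExt p (lam (i + 1)) (fs i)) :
    ∃ F : ℝ → ℝ, ContinuousOn F (Set.Icc 0 1) ∧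
      TendstoUniformlyOn (fun i => interp p (n₀ + i) (fs i)) F Filter.atTop
        (Set.Icc 0 1) := by
  have hp1 : p < 1 := by linarith
  have hc : 0 < 1 - 2 * p := by linarith
  have hmem : ∀ i, lam i ∈ Set.Icc (0 : ℝ) 2 := by
    intro i
    induction i with
    | zero => exact hlam0
    | succ i ih =>
      have h := hφmem _ ih
      rw [hlam]
      exact ⟨h.1, by linarith [h.2.trans (min_le_left _ _)]⟩
  have hlamp : ∀ i, lam (i + 1) ≤ p := fun i => by
    rw [hlam]
    exact (hφmem _ (hmem i)).2.trans (min_le_left _ _)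
  have hgeo : ∀ i, lam i ≤ 2 * (1 / 4) ^ i := by
    intro i
    induction i with
    | zero => simpa using hlam0.2
    | succ i ih =>
      have h := le_R_div_four hp0 hp (hmem (i + 1)).1 (hlamp i)
      rw [hlam, hφinv _ (hmem i)] at h
      rw [hlam, pow_succ]
      linarith
  obtain ⟨M, hM0, hM⟩ : ∃ M, 0 ≤ M ∧ ∀ k ≤ 3 ^ n₀, |fs 0 k| ≤ M :=
    ⟨∑ k ∈ Finset.range (3 ^ n₀ + 1), |fs 0 k|, Finset.sum_nonneg fun _ _ => abs_nonneg _,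
      fun k hk => Finset.single_le_sum (f := fun k => |fs 0 k|) (fun _ _ => abs_nonneg _)
        (Finset.mem_range.2 (by omega))⟩
  have hbound : ∀ i, ∀ k ≤ 3 ^ (n₀ + i),
      |fs i k| ≤ M * Real.exp ((1 - (1 / 4) ^ i) / (1 - 2 * p)) := by
    intro i
    induction i with
    | zero => simpa using hM
    | succ i ih =>
      intro k hk
      rw [hfs]
      refine (abs_sdExt_le hp0 hp (hmem (i + 1)).1 (hlamp i) ih hk).trans ?_
      have h1 : 1 + lam (i + 1) / (1 - 2 * p) ≤
          Real.exp (((1 / 4) ^ i - (1 / 4) ^ (i + 1)) / (1 - 2 * p)) := by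
        rw [add_comm]
        refine (Real.add_one_le_exp _).trans (Real.exp_le_exp.2 ?_)
        gcongr
        have h2 := hgeo (i + 1)
        have h3 : (0 : ℝ) < (1 / 4) ^ i := by positivity
        rw [pow_succ] at h2 ⊢
        linarith
      calc (1 + lam (i + 1) / (1 - 2 * p)) *
            (M * Real.exp ((1 - (1 / 4) ^ i) / (1 - 2 * p)))
          ≤ Real.exp (((1 / 4) ^ i - (1 / 4) ^ (i + 1)) / (1 - 2 * p)) *
            (M * Real.exp ((1 - (1 / 4) ^ i) / (1 - 2 * p))) := by gcongr
        _ = M * Real.exp ((1 - (1 / 4) ^ (i + 1)) / (1 - 2 * p)) := by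
          rw [mul_left_comm, ← Real.exp_add]
          congr 2
          ring
  set K := M * Real.exp (1 / (1 - 2 * p)) with hK
  have hK0 : 0 ≤ K := by positivity
  have hbound' : ∀ i, ∀ k ≤ 3 ^ (n₀ + i), |fs i k| ≤ K := fun i k hk => by
    refine (hbound i k hk).trans ?_
    rw [hK]
    gcongr
    have : (0 : ℝ) < (1 / 4) ^ i := by positivity
    linarith
  refine continuous_limit_of_geometric (C := 2 * K / (1 - 2 * p)) (r := 1 / 4) (by norm_num)
    (by norm_num) (fun i => continuousOn_interp hp0 hp1 _ _) fun i x hx => ?_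
  rw [← interp_sdExt_zero hp0 hp1 (n₀ + i) (fs i) hx, hfs, ← add_assoc]
  refine (abs_interp_sub_le hp0 hp1 (fun m hm =>
    abs_sdExt_sub_le hp0 hp (hmem (i + 1)).1 (hlamp i) (hbound' i) hm) hx).trans ?_
  calc 4 * K * lam (i + 1) / (1 - 2 * p)
      ≤ 4 * K * (2 * (1 / 4) ^ (i + 1)) / (1 - 2 * p) := by
        gcongr
        exact hgeo (i + 1)
    _ = 2 * K / (1 - 2 * p) * (1 / 4) ^ i := by ring
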